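/- arXiv:2512.05123 — 2 statements merged into one kernel-verified Lean document; each statement's English description precedes it below -/
import Mathlib

section
/- Let n ≥ 1 be a natural number with base-10 digit list L = Nat.digits 10 n (so L.get i is the digit of 10^i). For any yupana state N, any weight b and row r, the abbreviated replication of n times a token on square (b, r) — namely removing one token from square (b, r) and depositing L.get i tokens on square (b, r + i) for each i < L.length — changes the value of the yupana by exactly (n - 1) * b * 10 ^ r, which is the same change produced by replicating that token n times on its own square: V (N - single (b, r) 1 + ∑ i < L.length, single (b, r + i) (L.get i)) = V N + (n - 1) * b * 10 ^ r. -/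
/-- The value of a yupana state: sum of effective values of all squares. -/
noncomputable def V (N : ℕ × ℕ →₀ ℤ) : ℤ :=
  ∑ p ∈ N.support, N p * (p.1 : ℤ) * 10 ^ p.2

/-- The value of a yupana state as an additive homomorphism. -/
noncomputable def valueHom : (ℕ × ℕ →₀ ℤ) →+ ℤ :=
  Finsupp.liftAddHom fun p => AddMonoidHom.mulRight ((p.1 : ℤ) * 10 ^ p.2)

theorem V_eq_valueHom (N : ℕ × ℕ →₀ ℤ) : V N = valueHom N := by
  simp [V, valueHom, Finsupp.sum, mul_assoc]

theorem valueHom_single (b r : ℕ) (c : ℤ) :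
    valueHom (Finsupp.single (b, r) c) = c * (b * 10 ^ r) := by
  simp [valueHom]

theorem sum_digits_get_mul_pow (n : ℕ) :
    ∑ i : Fin (Nat.digits 10 n).length, ((Nat.digits 10 n).get i : ℤ) * 10 ^ (i : ℕ) = n := by
  have key : ∀ L : List ℕ,
      ∑ i : Fin L.length, (L.get i : ℤ) * 10 ^ (i : ℕ) = (Nat.ofDigits 10 L : ℕ) := by
    intro L
    induction L with
    | nil => simp
    | cons d L ih =>
      rw [Nat.ofDigits_cons]
      push_cast at ih ⊢
      rw [← ih, Finset.mul_sum]
      refine (Fin.sum_univ_succ (n := L.length) _).trans ?_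
      simp [pow_succ', mul_left_comm]
  rw [key, Nat.ofDigits_digits]

/-- Abbreviated replication of n times a token on square (b, r): removing one token
from (b, r) and depositing the i-th base-10 digit of n many tokens on (b, r + i)
changes the value by exactly (n - 1) * b * 10 ^ r. -/
theorem abbreviated_replication (n : ℕ) (hn : 1 ≤ n) (N : ℕ × ℕ →₀ ℤ) (b r : ℕ) :
    V (N - Finsupp.single (b, r) 1 +
        ∑ i : Fin (Nat.digits 10 n).length,
          Finsupp.single (b, r + (i : ℕ)) (((Nat.digits 10 n).get i : ℤ))) =
      V N + ((n : ℤ) - 1) * (b : ℤ) * 10 ^ r := by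
  have hsum : ∑ i : Fin (Nat.digits 10 n).length,
      ((Nat.digits 10 n).get i : ℤ) * (b * 10 ^ (r + (i : ℕ))) = n * (b * 10 ^ r) := by
    conv_rhs => rw [← sum_digits_get_mul_pow n, Finset.sum_mul]
    exact Finset.sum_congr rfl fun i _ => by ring
  simp only [V_eq_valueHom, map_add, map_sub, map_sum, valueHom_single]
  rw [hsum]
  ring
end

section
/- Every natural number n with n < 10 ^ m can be represented on a yupana of m rows following the rules of representation: there exists a finitely supported function N : ℕ × ℕ →₀ ℕ such that (i) every (b, r) in the support of N satisfies b ∈ {1, 2, 3, 5} and r < m, (ii) N (b, r) ≤ 1 for every square (i.e. each square holds at most one token), (iii) each row holds at most 3 tokens, i.e. for every r, ∑ b in {1, 2, 3, 5}, N (b, r) ≤ 3, and (iv) the value of the state is n: ∑ (b, r) in N.support, N (b, r) * b * 10 ^ r = n. -/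
/-- Every decimal digit is a sum of at most three distinct weights among 1, 2, 3, 5. -/
theorem exists_weights_sum_eq_digit :
    ∀ d < 10, ∃ T ∈ ({1, 2, 3, 5} : Finset ℕ).powerset, T.card ≤ 3 ∧ ∑ b ∈ T, b = d := by
  decide

theorem sum_digits_mul_pow_eq_mod (b n m : ℕ) :
    ∑ r ∈ Finset.range m, n / b ^ r % b * b ^ r = n % b ^ m := by
  induction m with
  | zero => simp [Nat.mod_one]
  | succ k ih => rw [Finset.sum_range_succ, ih, Nat.mod_pow_succ, mul_comm (b ^ k)]

/-- Every natural number n < 10 ^ m can be represented on a yupana of m rows following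
the rules of representation: tokens only on squares of weight 1, 2, 3 or 5 in rows
below m, at most one token per square, at most 3 tokens per row, with total
effective value n. -/
theorem yupana_representation (m n : ℕ) (hn : n < 10 ^ m) :
    ∃ N : ℕ × ℕ →₀ ℕ,
      (∀ p ∈ N.support, p.1 ∈ ({1, 2, 3, 5} : Finset ℕ) ∧ p.2 < m) ∧
      (∀ p : ℕ × ℕ, N p ≤ 1) ∧
      (∀ r : ℕ, ∑ b ∈ ({1, 2, 3, 5} : Finset ℕ), N (b, r) ≤ 3) ∧
      (∑ p ∈ N.support, (N p : ℕ) * p.1 * 10 ^ p.2 = n) := by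
  choose T hT hcard hsum using fun r : ℕ =>
    exists_weights_sum_eq_digit (n / 10 ^ r % 10) (Nat.mod_lt _ (by norm_num))
  simp only [Finset.mem_powerset] at hT
  set S : Finset (ℕ × ℕ) :=
    (({1, 2, 3, 5} : Finset ℕ) ×ˢ Finset.range m).filter (fun p => p.1 ∈ T p.2) with hS
  let N : ℕ × ℕ →₀ ℕ := Finsupp.indicator S (fun _ _ => 1)
  have hN (p : ℕ × ℕ) : N p = if p ∈ S then 1 else 0 := by
    simp [N, Finsupp.indicator_apply]
  have hsupp : N.support = S := by
    ext p
    simp [hN]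
  refine ⟨N, ?_, ?_, ?_, ?_⟩
  · intro p hp
    rw [hsupp, hS, Finset.mem_filter, Finset.mem_product, Finset.mem_range] at hp
    exact hp.1
  · intro p
    rw [hN]
    split_ifs <;> simp
  · intro r
    simp only [hN]
    rw [← Finset.card_filter]
    refine (Finset.card_le_card fun b hb => ?_).trans (hcard r)
    exact (Finset.mem_filter.mp (Finset.mem_filter.mp hb).2).2
  · rw [hsupp]
    calc ∑ p ∈ S, N p * p.1 * 10 ^ p.2 = ∑ p ∈ S, p.1 * 10 ^ p.2 :=
          Finset.sum_congr rfl fun p hp => by rw [hN, if_pos hp, one_mul]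
      _ = ∑ r ∈ Finset.range m, n / 10 ^ r % 10 * 10 ^ r := by
          rw [hS, Finset.sum_filter, Finset.sum_product_right]
          refine Finset.sum_congr rfl fun r _ => ?_
          dsimp only
          rw [← Finset.sum_filter, Finset.filter_mem_eq_inter,
            Finset.inter_eq_right.mpr (hT r), ← Finset.sum_mul, hsum]
      _ = n := by rw [sum_digits_mul_pow_eq_mod, Nat.mod_eq_of_lt hn]
end
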